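/- Let B₀ and B₁ be the matrices of the diagonalizable case with parameters a, b, c (a ≠ b, r ≠ 0), i.e. B₀ = [[a(b−c)/(a−b), r],[ab(a−c)(c−b)/(r(a−b)²), b(c−a)/(a−b)]], B₁ = [[a(c−a)/(a−b), −r],[−ab(a−c)(c−b)/(r(a−b)²), b(b−c)/(a−b)]]. If (φ, ξ) is a solution of the linear system d/dz (φ, ξ)ᵀ = [B₀/z + B₁/(z−1)]·(φ, ξ)ᵀ on a domain avoiding 0 and 1, then φ satisfies the hypergeometric equation z(1−z)φ'' + (1+c − (a + b + 2)z)φ' − a(b+1)φ = 0, and ξ = (1/r)[z(1−z)φ' − a(z + (b−c)/(a−b))φ]. -/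

import Mathlib

open Matrix

theorem fuchsian_system_reduces_to_hypergeometric
    (a b c r : ℂ) (hab : a ≠ b) (hr : r ≠ 0)
    (s : Set ℂ) (hs : IsOpen s) (hs01 : ∀ z ∈ s, z ≠ 0 ∧ z ≠ 1)
    (φ ξ : ℂ → ℂ)
    (B₀ : Matrix (Fin 2) (Fin 2) ℂ)
    (B₁ : Matrix (Fin 2) (Fin 2) ℂ)
    (hB₀ : B₀ = !![a * (b - c) / (a - b), r;
        a * b * (a - c) * (c - b) / (r * (a - b) ^ 2), b * (c - a) / (a - b)])
    (hB₁ : B₁ = !![a * (c - a) / (a - b), -r;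
        -(a * b * (a - c) * (c - b) / (r * (a - b) ^ 2)), b * (b - c) / (a - b)])
    (hφ : ∀ z ∈ s, HasDerivAt φ
      ((B₀ 0 0 / z + B₁ 0 0 / (z - 1)) * φ z + (B₀ 0 1 / z + B₁ 0 1 / (z - 1)) * ξ z) z)
    (hξ : ∀ z ∈ s, HasDerivAt ξ
      ((B₀ 1 0 / z + B₁ 1 0 / (z - 1)) * φ z + (B₀ 1 1 / z + B₁ 1 1 / (z - 1)) * ξ z) z) :
    ∀ z ∈ s,
      (z * (1 - z) * deriv (deriv φ) z + (1 + c - (a + b + 2) * z) * deriv φ z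
          - a * (b + 1) * φ z = 0) ∧
      ξ z = (1 / r) * (z * (1 - z) * deriv φ z - a * (z + (b - c) / (a - b)) * φ z) := by
  have hd : a - b ≠ 0 := sub_ne_zero.mpr hab
  obtain ⟨α, hα⟩ : ∃ α, α = a * (b - c) / (a - b) := ⟨_, rfl⟩
  obtain ⟨β, hβ⟩ : ∃ β, β = b * (c - a) / (a - b) := ⟨_, rfl⟩
  obtain ⟨g, hg⟩ : ∃ g, g = a * b * (a - c) * (c - b) / (r * (a - b) ^ 2) := ⟨_, rfl⟩
  have e1 : a * (c - a) / (a - b) = -a - α := by rw [hα]; field_simp; ring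
  have e2 : b * (b - c) / (a - b) = -b - β := by rw [hβ]; field_simp; ring
  have e3 : α + β = -c := by rw [hα, hβ]; field_simp; ring
  have e4 : r * g = α * β := by rw [hα, hβ, hg]; field_simp; ring
  have e5 : α * b + a * β = -(a * b) := by rw [hα, hβ]; field_simp; ring
  have e6 : ∀ z : ℂ, a * (z + (b - c) / (a - b)) = a * z + α := by
    intro z; rw [hα]; field_simp
  rw [← hα, ← hβ, ← hg] at hB₀
  rw [e1, e2, ← hg] at hB₁
  clear hα hβ hg
  subst hB₀ hB₁
  simp only [Matrix.of_apply, Matrix.cons_val', Matrix.cons_val_zero, Matrix.cons_val_one,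
    Matrix.cons_val_fin_one] at hφ hξ
  have hφ' : ∀ z ∈ s, HasDerivAt φ (((α + a * z) * φ z + r * ξ z) / (z * (1 - z))) z := by
    intro z hz
    obtain ⟨h0, h1⟩ := hs01 z hz
    have h2 : z - 1 ≠ 0 := sub_ne_zero.mpr h1
    have h3 : 1 - z ≠ 0 := sub_ne_zero.mpr h1.symm
    convert hφ z hz using 1
    rw [show (1 - z) = -(z - 1) by ring]
    field_simp
    ring
  have hξ' : ∀ z ∈ s, HasDerivAt ξ ((g * φ z + (β + b * z) * ξ z) / (z * (1 - z))) z := by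
    intro z hz
    obtain ⟨h0, h1⟩ := hs01 z hz
    have h2 : z - 1 ≠ 0 := sub_ne_zero.mpr h1
    have h3 : 1 - z ≠ 0 := sub_ne_zero.mpr h1.symm
    convert hξ z hz using 1
    rw [show (1 - z) = -(z - 1) by ring]
    field_simp
    ring
  intro z hz
  obtain ⟨h0, h1⟩ := hs01 z hz
  have h3 : 1 - z ≠ 0 := sub_ne_zero.mpr h1.symm
  have hD : z * (1 - z) ≠ 0 := mul_ne_zero h0 h3
  have hev : deriv φ =ᶠ[nhds z] fun w => ((α + a * w) * φ w + r * ξ w) / (w * (1 - w)) := by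
    filter_upwards [hs.mem_nhds hz] with w hw using (hφ' w hw).deriv
  have hP := hφ' z hz
  have hX := hξ' z hz
  obtain ⟨P, hPd⟩ : ∃ P, P = ((α + a * z) * φ z + r * ξ z) / (z * (1 - z)) := ⟨_, rfl⟩
  obtain ⟨X, hXd⟩ : ∃ X, X = (g * φ z + (β + b * z) * ξ z) / (z * (1 - z)) := ⟨_, rfl⟩
  rw [← hPd] at hP
  rw [← hXd] at hX
  have hl : HasDerivAt (fun w : ℂ => α + a * w) a z := by
    simpa using ((hasDerivAt_id z).const_mul a).const_add α
  have hq : HasDerivAt (fun w : ℂ => w * (1 - w)) (1 - 2 * z) z := by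
    have h := (hasDerivAt_id' z).mul ((hasDerivAt_id' z).const_sub 1)
    have e : 1 * (1 - z) + z * (-1) = 1 - 2 * z := by ring
    rw [← e]
    exact h
  have hdd := ((hl.mul hP).add (hX.const_mul r)).div hq hD
  have hdd2 := (hdd.congr_of_eventuallyEq hev).deriv
  have hPm : z * (1 - z) * P = (α + a * z) * φ z + r * ξ z := by rw [hPd]; field_simp
  have hXm : z * (1 - z) * X = g * φ z + (β + b * z) * ξ z := by rw [hXd]; field_simp
  rw [hP.deriv]
  constructor
  · have hdm : z * (1 - z) * deriv (deriv φ) z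
        = a * φ z + (α + a * z) * P + r * X - (1 - 2 * z) * P := by
      rw [hdd2]
      simp only [Pi.add_apply, Pi.mul_apply]
      rw [← hPm]
      field_simp
    rw [hdm]
    apply mul_left_cancel₀ hD
    linear_combination r * hXm + φ z * e4 - (β + b * z) * hPm + z * (1 - z) * P * e3 - z * φ z * e5
  · rw [e6, hPm]
    field_simp
    ring
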